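/- Let D be an unbounded self-adjoint operator on a complex Hilbert space H and p an orthogonal projection on H with p·dom(D) ⊆ dom(D) and [D, p] bounded on dom(D). Then (1 − p)·dom(D) ⊆ dom(D); the operator D̃ := pDp + (1 − p)D(1 − p) with domain dom(D) satisfies D̃ = D − pD(1 − p) − (1 − p)Dp on dom(D), where pD(1 − p) + (1 − p)Dp extends to a bounded symmetric operator on H; D̃ commutes with p (i.e., D̃pξ = pD̃ξ for all ξ ∈ dom(D)); D̃ is self-adjoint; and if D has compact resolvent, then D̃ has compact resolvent. -/

import Mathlib

/-- `R` is the (bounded, two-sided) inverse of `lam • 1 - T`, i.e. `lam` lies in the resolvent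
set of the unbounded operator `T` and `R = (lam • 1 - T)⁻¹`. -/
def IsResolventAt {H : Type*} [NormedAddCommGroup H] [InnerProductSpace ℂ H]
    (T : H →ₗ.[ℂ] H) (lam : ℂ) (R : H →L[ℂ] H) : Prop :=
  (∀ ξ : T.domain, R (lam • (ξ : H) - T ξ) = ξ) ∧
    ∀ η : H, ∃ h : R η ∈ T.domain, lam • (R η) - T ⟨R η, h⟩ = η

/-- The unbounded operator `T` has compact resolvent: some `lam` lies in its resolvent set and
the corresponding resolvent operator is compact. -/
def HasCompactResolvent {H : Type*} [NormedAddCommGroup H] [InnerProductSpace ℂ H]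
    (T : H →ₗ.[ℂ] H) : Prop :=
  ∃ (lam : ℂ) (R : H →L[ℂ] H), IsResolventAt T lam R ∧ IsCompactOperator ⇑R

namespace LinearPMap

variable {H : Type*} [NormedAddCommGroup H] [InnerProductSpace ℂ H]

/-- A self-adjoint unbounded operator is symmetric. -/
theorem inner_apply_right_of_isSelfAdjoint [CompleteSpace H] {A : H →ₗ.[ℂ] H}
    (hA : IsSelfAdjoint A) (x y : A.domain) : inner ℂ (A x) (y : H) = inner ℂ (x : H) (A y) := by
  have h := adjoint_isFormalAdjoint (T := A) hA.dense_domain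
  rw [isSelfAdjoint_def.mp hA] at h
  exact h x y

/-- A vector `y` for which `inner ℂ y (A ·)` is represented by `w` lies in the domain of a
self-adjoint operator `A`, and `A y = w`. -/
theorem exists_apply_eq_of_isSelfAdjoint [CompleteSpace H] {A : H →ₗ.[ℂ] H}
    (hA : IsSelfAdjoint A) {y w : H} (h : ∀ x : A.domain, inner ℂ w (x : H) = inner ℂ y (A x)) :
    ∃ hy : y ∈ A.domain, A ⟨y, hy⟩ = w := by
  have hy : y ∈ A†.domain := mem_adjoint_domain_of_exists y ⟨w, h⟩
  have hw : A† ⟨y, hy⟩ = w := adjoint_apply_eq hA.dense_domain ⟨y, hy⟩ h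
  have hmem : (y, w) ∈ A†.graph := (mem_graph_iff A†).mpr ⟨⟨y, hy⟩, rfl, hw⟩
  rw [isSelfAdjoint_def.mp hA, mem_graph_iff] at hmem
  obtain ⟨z, hz, hz'⟩ := hmem
  simp only at hz hz'
  subst hz
  exact ⟨z.2, hz'⟩

/-- A densely defined symmetric operator whose domain contains every vector of the domain of its
adjoint is self-adjoint. -/
theorem isSelfAdjoint_of_symmetric [CompleteSpace H] {A : H →ₗ.[ℂ] H}
    (hd : Dense (A.domain : Set H))
    (hs : ∀ x y : A.domain, inner ℂ (A x) (y : H) = inner ℂ (x : H) (A y))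
    (hm : ∀ y w : H, (∀ x : A.domain, inner ℂ w (x : H) = inner ℂ y (A x)) → y ∈ A.domain) :
    IsSelfAdjoint A := by
  rw [isSelfAdjoint_def]
  refine (eq_of_le_of_domain_eq (IsFormalAdjoint.le_adjoint hd hs) ?_).symm
  refine le_antisymm (IsFormalAdjoint.le_adjoint hd hs).1 fun y hy => ?_
  exact hm y (A† ⟨y, hy⟩) fun x => adjoint_isFormalAdjoint hd ⟨y, hy⟩ x

/-- If `S = T - b` on the common domain, with `T` self-adjoint and `b` bounded self-adjoint, then
`S` is self-adjoint. -/
theorem isSelfAdjoint_of_eq_sub [CompleteSpace H] {T S : H →ₗ.[ℂ] H} (hT : IsSelfAdjoint T)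
    {b : H →L[ℂ] H} (hb : IsSelfAdjoint b) (hdom : S.domain = T.domain)
    (hS : ∀ (ξ : S.domain) (h : (ξ : H) ∈ T.domain), S ξ = T ⟨(ξ : H), h⟩ - b ξ) :
    IsSelfAdjoint S := by
  have hbs : ∀ x y : H, inner ℂ (b x) y = inner ℂ x (b y) := fun x y => hb.isSymmetric x y
  have hST : ∀ x : S.domain, (x : H) ∈ T.domain := fun x => hdom ▸ x.2
  have hTS : ∀ x : T.domain, (x : H) ∈ S.domain := fun x => hdom.symm ▸ x.2
  refine isSelfAdjoint_of_symmetric (hdom ▸ hT.dense_domain) (fun x y => ?_) fun y w h => ?_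
  · rw [hS x (hST x), hS y (hST y), inner_sub_left, inner_sub_right, hbs,
      inner_apply_right_of_isSelfAdjoint hT ⟨x, hST x⟩ ⟨y, hST y⟩]
  · obtain ⟨hy, -⟩ := exists_apply_eq_of_isSelfAdjoint hT (y := y) (w := w + b y) fun x => by
      have h' := h ⟨x, hTS x⟩
      rw [hS ⟨x, hTS x⟩ x.2, inner_sub_right] at h'
      rw [inner_add_left, hbs, h']
      simp
    exact hdom.symm ▸ hy

/-- `‖i x - y‖² = ‖x‖² + ‖y‖²` if the inner product of `x` and `y` is real. -/
theorem norm_I_smul_sub_sq_of_inner_comm {x y : H} (h : inner ℂ y x = inner ℂ x y) :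
    ‖Complex.I • x - y‖ ^ 2 = ‖x‖ ^ 2 + ‖y‖ ^ 2 := by
  have him : (inner ℂ x y).im = 0 := by
    rw [← inner_conj_symm] at h
    exact Complex.conj_eq_iff_im.mp h
  rw [@norm_sub_sq ℂ, norm_smul, inner_smul_left]
  simp [him]

/-- `i` lies in the resolvent set of every self-adjoint operator. -/
theorem exists_isResolventAt_I [CompleteSpace H] {A : H →ₗ.[ℂ] H} (hA : IsSelfAdjoint A) :
    ∃ R : H →L[ℂ] H, IsResolventAt A Complex.I R := by
  have hsym : ∀ x : A.domain, ‖Complex.I • (x : H) - A x‖ ^ 2 = ‖(x : H)‖ ^ 2 + ‖A x‖ ^ 2 :=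
    fun x => norm_I_smul_sub_sq_of_inner_comm (inner_apply_right_of_isSelfAdjoint hA x x)
  have hx : ∀ x : A.domain, ‖(x : H)‖ ≤ ‖Complex.I • (x : H) - A x‖ := fun x =>
    le_of_sq_le_sq (by nlinarith [hsym x, sq_nonneg ‖A x‖]) (norm_nonneg _)
  have hAx : ∀ x : A.domain, ‖A x‖ ≤ ‖Complex.I • (x : H) - A x‖ := fun x =>
    le_of_sq_le_sq (by nlinarith [hsym x, sq_nonneg ‖(x : H)‖]) (norm_nonneg _)
  let f : A.domain →ₗ[ℂ] H := Complex.I • A.domain.subtype - A.toFun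
  have hf : ∀ x : A.domain, f x = Complex.I • (x : H) - A x := fun _ => rfl
  have hinj : Function.Injective f := by
    rw [injective_iff_map_eq_zero]
    intro x h0
    have := hx x
    rw [← hf, h0, norm_zero] at this
    exact Subtype.ext (norm_le_zero_iff.mp this)
  let g : A.graph →L[ℂ] H :=
    (Complex.I • ContinuousLinearMap.fst ℂ H H - ContinuousLinearMap.snd ℂ H H).comp
      A.graph.subtypeL
  have hgf : ∀ z : A.graph, ∃ x : A.domain, (z : H × H) = (↑x, A x) ∧ g z = f x := by
    rintro ⟨z, hz⟩
    obtain ⟨x, hx1, hx2⟩ := (mem_graph_iff A).mp hz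
    refine ⟨x, Prod.ext hx1.symm hx2.symm, ?_⟩
    rw [hf, hx1, hx2]
    rfl
  have hclosed : _root_.IsClosed (Set.range g) := by
    have : CompleteSpace A.graph :=
      (show _root_.IsClosed (A.graph : Set (H × H)) from hA.isClosed).completeSpace_coe
    refine AntilipschitzWith.isClosed_range (K := 1)
      (AddMonoidHomClass.antilipschitz_of_bound g fun z => ?_) g.uniformContinuous
    obtain ⟨x, hz, hgz⟩ := hgf z
    rw [hgz, NNReal.coe_one, one_mul, hf]
    change ‖(z : H × H)‖ ≤ _
    rw [hz]
    exact max_le (hx x) (hAx x)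
  have hrange : (LinearMap.range f : Set H) = Set.range g := by
    ext w
    constructor
    · rintro ⟨x, rfl⟩
      exact ⟨⟨(↑x, A x), mem_graph A x⟩, rfl⟩
    · rintro ⟨z, rfl⟩
      obtain ⟨x, -, h⟩ := hgf z
      exact ⟨x, h.symm⟩
  have hsurj : Function.Surjective f := by
    rw [← LinearMap.range_eq_top]
    have : CompleteSpace (LinearMap.range f) :=
      (show _root_.IsClosed (LinearMap.range f : Set H) from hrange ▸ hclosed).completeSpace_coe
    rw [← Submodule.orthogonal_eq_bot_iff, Submodule.eq_bot_iff]
    intro y hy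
    obtain ⟨hyd, hyA⟩ := exists_apply_eq_of_isSelfAdjoint hA (y := y) (w := -Complex.I • y)
      fun x => by
        have h0 := (Submodule.mem_orthogonal' _ _).mp hy (f x) ⟨x, rfl⟩
        rw [hf, inner_sub_right, inner_smul_right, sub_eq_zero] at h0
        rw [inner_smul_left, ← h0]
        simp
    have h3 := inner_apply_right_of_isSelfAdjoint hA ⟨y, hyd⟩ ⟨y, hyd⟩
    have hconj : (starRingEnd ℂ) (-Complex.I) = Complex.I := by simp
    simp only [hyA, inner_smul_left, inner_smul_right, hconj] at h3
    have h4 : (2 * Complex.I) * inner ℂ y y = 0 := by linear_combination h3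
    simpa using h4
  let e := LinearEquiv.ofBijective f ⟨hinj, hsurj⟩
  have hef : ∀ η, f (e.symm η) = η := fun η => e.apply_symm_apply η
  refine ⟨(A.domain.subtype ∘ₗ e.symm.toLinearMap).mkContinuous 1 fun η => ?_, fun ξ => ?_,
    fun η => ⟨(e.symm η).2, hef η⟩⟩
  · rw [one_mul]
    refine (hx (e.symm η)).trans_eq ?_
    rw [← hf, hef]
  · exact congrArg Subtype.val (e.symm_apply_apply ξ)

end LinearPMap

/-- Compactness of the resolvent passes from `T` to any bounded perturbation with nonempty
resolvent set. -/
theorem IsResolventAt.isCompactOperator_of_eq_sub {H : Type*} [NormedAddCommGroup H]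
    [InnerProductSpace ℂ H] {T S : H →ₗ.[ℂ] H} {b : H →L[ℂ] H} (hdom : S.domain ≤ T.domain)
    (hS : ∀ (ξ : S.domain) (h : (ξ : H) ∈ T.domain), S ξ = T ⟨(ξ : H), h⟩ - b ξ)
    {lam mu : ℂ} {R Q : H →L[ℂ] H} (hR : IsResolventAt T lam R) (hQ : IsResolventAt S mu Q)
    (hc : IsCompactOperator R) : IsCompactOperator Q := by
  have key : Q = R.comp ((lam - mu) • Q + ContinuousLinearMap.id ℂ H - b.comp Q) := by
    ext η
    obtain ⟨h, hη⟩ := hQ.2 η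
    have h1 := hR.1 ⟨Q η, hdom h⟩
    rw [hS ⟨Q η, h⟩ (hdom h)] at hη
    conv_lhs => rw [← show R _ = Q η from h1]
    simp only [ContinuousLinearMap.comp_apply, sub_apply,
      add_apply, smul_apply, ContinuousLinearMap.id_apply]
    congr 1
    linear_combination (norm := module) hη
  rw [key]
  exact hc.comp_clm _

/-- A linear map on a dense submodule that is bounded there extends to a bounded operator. -/
theorem LinearMap.exists_continuousLinearMap_extension {H : Type*} [NormedAddCommGroup H]
    [NormedSpace ℂ H] [CompleteSpace H] {V : Submodule ℂ H} (hV : Dense (V : Set H))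
    (f : V →ₗ[ℂ] H) {C : ℝ} (hf : ∀ x, ‖f x‖ ≤ C * ‖(x : H)‖) :
    ∃ c : H →L[ℂ] H, ∀ x : V, c x = f x := by
  refine ⟨(f.mkContinuous C hf).extend V.subtypeL, fun x => ?_⟩
  exact ContinuousLinearMap.extend_eq (f.mkContinuous C hf) (e := V.subtypeL)
    (by simpa [DenseRange] using hV) isUniformEmbedding_subtype_val.isUniformInducing x

/-- Let `T` be an unbounded self-adjoint operator on a complex Hilbert space `H`
and `p` an orthogonal projection with `p · dom T ⊆ dom T` and `[T, p]` bounded on `dom T`.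
Then `(1 - p) · dom T ⊆ dom T`; the operator `S = p T p + (1 - p) T (1 - p)` with domain `dom T`
satisfies `S = T - (p T (1 - p) + (1 - p) T p)` on `dom T`, where `p T (1 - p) + (1 - p) T p`
extends to a bounded symmetric (self-adjoint) operator `b` on `H`; `S` commutes with `p`;
`S` is self-adjoint; and if `T` has compact resolvent then so does `S`. -/
theorem statement3 {H : Type*} [NormedAddCommGroup H] [InnerProductSpace ℂ H] [CompleteSpace H]
    (T : H →ₗ.[ℂ] H) (hsaT : IsSelfAdjoint T)
    (p : H →L[ℂ] H) (hp_sa : IsSelfAdjoint p) (hp_idem : IsIdempotentElem p)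
    (hp_dom : ∀ ξ ∈ T.domain, p ξ ∈ T.domain)
    (hp_comm : ∃ C : ℝ, ∀ (ξ : T.domain) (h : p ↑ξ ∈ T.domain),
      ‖T ⟨p ↑ξ, h⟩ - p (T ξ)‖ ≤ C * ‖(ξ : H)‖)
    (S : H →ₗ.[ℂ] H) (hSdom : S.domain = T.domain)
    (hS : ∀ (ξ : S.domain) (h₁ : p ↑ξ ∈ T.domain) (h₂ : (1 - p) ↑ξ ∈ T.domain),
      S ξ = p (T ⟨p ↑ξ, h₁⟩) + (1 - p) (T ⟨(1 - p) ↑ξ, h₂⟩)) :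
    (∀ ξ ∈ T.domain, (1 - p) ξ ∈ T.domain) ∧
    (∃ b : H →L[ℂ] H, IsSelfAdjoint b ∧
      (∀ (ξ : T.domain) (h₁ : p ↑ξ ∈ T.domain) (h₂ : (1 - p) ↑ξ ∈ T.domain),
        b ↑ξ = p (T ⟨(1 - p) ↑ξ, h₂⟩) + (1 - p) (T ⟨p ↑ξ, h₁⟩)) ∧
      (∀ (ξ : S.domain) (h : (ξ : H) ∈ T.domain), S ξ = T ⟨(ξ : H), h⟩ - b ↑ξ)) ∧
    (∀ (ξ : S.domain) (h : p ↑ξ ∈ S.domain), S ⟨p ↑ξ, h⟩ = p (S ξ)) ∧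
    IsSelfAdjoint S ∧
    (HasCompactResolvent T → HasCompactResolvent S) := by
  have hT := hsaT.dense_domain
  have hps : ∀ x y : H, inner ℂ (p x) y = inner ℂ x (p y) := fun x y => hp_sa.isSymmetric x y
  have hpp : ∀ x : H, p (p x) = p x := fun x => congrArg (fun q : H →L[ℂ] H => q x) hp_idem
  have hq_dom : ∀ ξ ∈ T.domain, (1 - p) ξ ∈ T.domain := fun ξ hξ =>
    T.domain.sub_mem hξ (hp_dom ξ hξ)
  have hTq : ∀ (ξ : T.domain) (h₁ : p ↑ξ ∈ T.domain) (h₂ : (1 - p) ↑ξ ∈ T.domain),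
      T ⟨(1 - p) ↑ξ, h₂⟩ = T ξ - T ⟨p ↑ξ, h₁⟩ := fun ξ h₁ h₂ => by
    rw [← T.map_sub]
    rfl
  have hdom : ∀ ξ : S.domain, (ξ : H) ∈ T.domain := fun ξ => hSdom ▸ ξ.2
  have hb : ∃ b : H →L[ℂ] H, IsSelfAdjoint b ∧
      ∀ (ξ : T.domain) (h₁ : p ↑ξ ∈ T.domain) (h₂ : (1 - p) ↑ξ ∈ T.domain),
        b ↑ξ = p (T ⟨(1 - p) ↑ξ, h₂⟩) + (1 - p) (T ⟨p ↑ξ, h₁⟩) := by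
    obtain ⟨C, hC⟩ := hp_comm
    obtain ⟨c, hc⟩ := LinearMap.exists_continuousLinearMap_extension hT
      (T.toFun ∘ₗ p.toLinearMap.restrict hp_dom - p.toLinearMap ∘ₗ T.toFun)
      (C := C) fun ξ => hC ξ (hp_dom ξ ξ.2)
    replace hc : ∀ ξ : T.domain, c ξ = T ⟨p ξ, hp_dom ξ ξ.2⟩ - p (T ξ) := hc
    have hbc : ∀ (ξ : T.domain) (h₁ : p ↑ξ ∈ T.domain) (h₂ : (1 - p) ↑ξ ∈ T.domain),
        (c - (2 : ℂ) • p.comp c) ↑ξ = p (T ⟨(1 - p) ↑ξ, h₂⟩) + (1 - p) (T ⟨p ↑ξ, h₁⟩) := by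
      intro ξ h₁ h₂
      rw [hTq ξ h₁ h₂]
      simp only [sub_apply, smul_apply,
        ContinuousLinearMap.comp_apply, hc, map_sub, hpp, one_apply_eq_self]
      module
    refine ⟨c - (2 : ℂ) • p.comp c, ?_, hbc⟩
    rw [ContinuousLinearMap.isSelfAdjoint_iff_isSymmetric]
    generalize c - (2 : ℂ) • p.comp c = b at hbc
    intro x y
    change inner ℂ (b x) y = inner ℂ x (b y)
    refine hT.induction (P := fun x => inner ℂ (b x) y = inner ℂ x (b y)) (fun x hx => ?_)
      (isClosed_eq (by fun_prop) (by fun_prop)) x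
    refine hT.induction (P := fun y => inner ℂ (b x) y = inner ℂ x (b y)) (fun y hy => ?_)
      (isClosed_eq (by fun_prop) (by fun_prop)) y
    have e₁ := hbc ⟨x, hx⟩ (hp_dom x hx) (hq_dom x hx)
    have e₂ := hbc ⟨y, hy⟩ (hp_dom y hy) (hq_dom y hy)
    have s := LinearPMap.inner_apply_right_of_isSelfAdjoint hsaT
    have s₁ := s ⟨(1 - p) x, hq_dom x hx⟩ ⟨p y, hp_dom y hy⟩
    have s₂ := s ⟨p x, hp_dom x hx⟩ ⟨(1 - p) y, hq_dom y hy⟩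
    simp only [sub_apply, one_apply_eq_self, inner_sub_left,
      inner_sub_right, hps] at e₁ e₂ s₁ s₂ ⊢
    simp only [e₁, e₂, inner_sub_left, inner_sub_right, inner_add_left, inner_add_right,
      hps] at s₁ s₂ ⊢
    simp only [← hps x] at s₁ s₂ ⊢
    linear_combination s₁ + s₂
  obtain ⟨b, hb_sa, hb⟩ := hb
  have hSb : ∀ (ξ : S.domain) (h : (ξ : H) ∈ T.domain), S ξ = T ⟨(ξ : H), h⟩ - b ↑ξ := by
    intro ξ h
    have h₁ := hp_dom ξ h
    have h₂ := hq_dom ξ h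
    rw [hS ξ h₁ h₂, hb ⟨ξ, h⟩ h₁ h₂, hTq ⟨ξ, h⟩ h₁ h₂]
    simp only [map_sub, sub_apply, one_apply_eq_self]
    module
  have hS_sa := LinearPMap.isSelfAdjoint_of_eq_sub hsaT hb_sa hSdom hSb
  refine ⟨hq_dom, ⟨b, hb_sa, hb, hSb⟩, fun ξ h => ?_, hS_sa, ?_⟩
  · have h₁ := hp_dom ξ (hdom ξ)
    have h₂ := hq_dom ξ (hdom ξ)
    have h₃ := hp_dom _ h₁
    have h₄ := hq_dom _ h₁
    have e₁ : T ⟨p (p ξ), h₃⟩ = T ⟨p ξ, h₁⟩ := by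
      congr 2
      exact hpp ξ
    rw [hS ξ h₁ h₂, hS ⟨p ξ, h⟩ h₃ h₄, hTq ⟨p ξ, h₁⟩ h₃ h₄, e₁]
    simp [hpp]
  · rintro ⟨lam, R, hR, hc⟩
    obtain ⟨Q, hQ⟩ := LinearPMap.exists_isResolventAt_I hS_sa
    exact ⟨Complex.I, Q, hQ, hR.isCompactOperator_of_eq_sub hSdom.le hSb hQ hc⟩
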